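/- Let n ≥ 1, let ρ : ℝⁿ → ℝ be smooth, ℤⁿ-periodic, and strictly positive, and let ψ : ℝⁿ → ℝⁿ be a smooth ℤⁿ-periodic vector field. Then ∫_{[0,1]ⁿ} Σᵢ ( Σⱼ ∂ⱼ( ρ ∂ᵢ∂ⱼ log ρ ) ) ψᵢ dx = ∫_{[0,1]ⁿ} ( 4 Σ_{i,j} ∂ᵢ(√ρ) ∂ⱼ(√ρ) ∂ⱼψᵢ − ρ Δ(div ψ) ) dx. -/

import Mathlib

/-- The partial derivative `∂ᵢ f` of a scalar function on `ℝⁿ`. -/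
noncomputable def pd {n : ℕ} (i : Fin n) (f : (Fin n → ℝ) → ℝ) (x : Fin n → ℝ) : ℝ :=
  fderiv ℝ f x (Pi.single i 1)

/-- A function on `ℝⁿ` is `ℤⁿ`-periodic if `f (x + k) = f x` for every `k ∈ ℤⁿ`. -/
def ZPeriodic {n : ℕ} {E : Type*} (f : (Fin n → ℝ) → E) : Prop :=
  ∀ (x : Fin n → ℝ) (k : Fin n → ℤ), f (x + fun i => (k i : ℝ)) = f x

section PartialDerivatives

variable {n : ℕ} {f g : (Fin n → ℝ) → ℝ}

lemma ContDiff.pd (hf : ContDiff ℝ (⊤ : ℕ∞) f) (i : Fin n) :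
    ContDiff ℝ (⊤ : ℕ∞) (pd i f) :=
  (hf.fderiv_right (m := (⊤ : ℕ∞)) (by simp)).clm_apply contDiff_const

lemma ZPeriodic.pd (hf : ZPeriodic f) (i : Fin n) : ZPeriodic (pd i f) := by
  intro x k
  have h : (fun y => f (y + fun i => (k i : ℝ))) = f := funext fun y => hf y k
  unfold _root_.pd
  rw [← fderiv_comp_add_right, h]

lemma ZPeriodic.mul (hf : ZPeriodic f) (hg : ZPeriodic g) :
    ZPeriodic (fun x => f x * g x) := fun x k => by
  simp only [hf x k, hg x k]

lemma ZPeriodic.add (hf : ZPeriodic f) (hg : ZPeriodic g) :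
    ZPeriodic (fun x => f x + g x) := fun x k => by
  simp only [hf x k, hg x k]

lemma pd_add (hf : ContDiff ℝ (⊤ : ℕ∞) f) (hg : ContDiff ℝ (⊤ : ℕ∞) g) (i : Fin n)
    (x : Fin n → ℝ) : pd i (fun y => f y + g y) x = pd i f x + pd i g x := by
  unfold pd
  rw [fderiv_fun_add (hf.differentiable (by simp) x) (hg.differentiable (by simp) x)]
  simp

lemma pd_mul (hf : ContDiff ℝ (⊤ : ℕ∞) f) (hg : ContDiff ℝ (⊤ : ℕ∞) g) (i : Fin n)
    (x : Fin n → ℝ) : pd i (fun y => f y * g y) x = pd i f x * g x + f x * pd i g x := by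
  unfold pd
  rw [fderiv_fun_mul (hf.differentiable (by simp) x) (hg.differentiable (by simp) x)]
  simp only [add_apply, smul_apply, smul_eq_mul]
  ring

lemma pd_sum {ι : Type*} (s : Finset ι) {F : ι → (Fin n → ℝ) → ℝ}
    (hF : ∀ a, ContDiff ℝ (⊤ : ℕ∞) (F a)) (i : Fin n) :
    pd i (fun y => ∑ a ∈ s, F a y) = fun x => ∑ a ∈ s, pd i (F a) x := by
  funext x
  unfold pd
  rw [fderiv_fun_sum fun a _ => (hF a).differentiable (by simp) x]
  simp

lemma pd_comm (hf : ContDiff ℝ (⊤ : ℕ∞) f) (i j : Fin n) :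
    pd i (pd j f) = pd j (pd i f) := by
  funext x
  have hd : DifferentiableAt ℝ (fderiv ℝ f) x :=
    (hf.fderiv_right (m := (⊤ : ℕ∞)) (by simp)).differentiable (by simp) x
  have key : ∀ a b : Fin n, pd a (pd b f) x
      = fderiv ℝ (fderiv ℝ f) x (Pi.single a 1) (Pi.single b 1) := fun a b => by
    unfold pd
    rw [fderiv_clm_apply hd (differentiableAt_const _)]
    simp
  rw [key, key]
  have htwo : minSmoothness ℝ 2 ≤ ((⊤ : ℕ∞) : WithTop ℕ∞) := by
    rw [minSmoothness_of_isRCLikeNormedField]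
    exact WithTop.coe_le_coe.2 (le_top : (2 : ℕ∞) ≤ ⊤)
  exact hf.contDiffAt.isSymmSndFDerivAt htwo _ _

/-- The integral over the unit cube of a partial derivative of a smooth periodic function
vanishes. -/
lemma integral_pd_eq_zero (hf : ContDiff ℝ (⊤ : ℕ∞) f) (hper : ZPeriodic f) (j : Fin n) :
    ∫ x in Set.Icc (0 : Fin n → ℝ) 1, pd j f x = 0 := by
  obtain _ | m := n
  · exact j.elim0
  let F : Fin (m + 1) → (Fin (m + 1) → ℝ) → ℝ := fun i x => if i = j then f x else 0
  let F' : Fin (m + 1) → (Fin (m + 1) → ℝ) → (Fin (m + 1) → ℝ) →L[ℝ] ℝ :=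
    fun i x => if i = j then fderiv ℝ f x else 0
  have hsum : ∀ x, ∑ i, F' i x (Pi.single i 1) = pd j f x := fun x => by
    rw [Finset.sum_eq_single j (fun i _ hi => by simp [F', hi]) (by simp)]
    simp [F', pd]
  have h := MeasureTheory.integral_divergence_of_hasFDerivAt_off_countable'
    (0 : Fin (m + 1) → ℝ) 1 (fun _ => zero_le_one) F F' ∅ Set.countable_empty
    (fun i => by
      by_cases hi : i = j
      · simpa [F, hi] using hf.continuous.continuousOn
      · simpa [F, hi] using continuousOn_const)
    (fun x _ i => by
      by_cases hi : i = j
      · simpa [F, F', hi] using (hf.differentiable (by simp) x).hasFDerivAt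
      · simpa [F, F', hi] using hasFDerivAt_const (0 : ℝ) x)
    (by
      simp only [hsum]
      exact (hf.pd j).continuous.continuousOn.integrableOn_compact isCompact_Icc)
  simp only [hsum] at h
  rw [h]
  refine Finset.sum_eq_zero fun i _ => sub_eq_zero.2 ?_
  refine MeasureTheory.integral_congr_ae (Filter.Eventually.of_forall fun y => ?_)
  by_cases hi : i = j
  · have hy : (i.insertNth (1 : ℝ) y : Fin (m + 1) → ℝ)
        = i.insertNth (0 : ℝ) y + fun a => ((Pi.single i (1 : ℤ) : Fin (m + 1) → ℤ) a : ℝ) := by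
      funext a
      induction a using i.succAboveCases <;> simp
    have hshift := hper (i.insertNth (0 : ℝ) y) (Pi.single i 1)
    rw [← hy] at hshift
    simpa only [F, if_pos hi, Pi.zero_apply, Pi.one_apply] using hshift
  · simp [F, hi]

lemma pd_log (hf : ContDiff ℝ (⊤ : ℕ∞) f) (hpos : ∀ x, 0 < f x) (i : Fin n)
    (x : Fin n → ℝ) : f x * pd i (fun y => Real.log (f y)) x = pd i f x := by
  unfold pd
  rw [fderiv.log (hf.differentiable (by simp) x) (hpos x).ne']
  simp [(hpos x).ne']

lemma pd_sqrt (hf : ContDiff ℝ (⊤ : ℕ∞) f) (hpos : ∀ x, 0 < f x) (i : Fin n)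
    (x : Fin n → ℝ) :
    2 * Real.sqrt (f x) * pd i (fun y => Real.sqrt (f y)) x = pd i f x := by
  have h : Real.sqrt (f x) ≠ 0 := (Real.sqrt_pos.2 (hpos x)).ne'
  unfold pd
  rw [fderiv_sqrt (hf.differentiable (by simp) x) (hpos x).ne']
  simp
  field_simp

/-- The pointwise identity `ρ ∇² log ρ = ∇² ρ - 4 ∇√ρ ⊗ ∇√ρ`. -/
lemma mul_pd_pd_log (hf : ContDiff ℝ (⊤ : ℕ∞) f) (hpos : ∀ x, 0 < f x) (i j : Fin n)
    (x : Fin n → ℝ) :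
    f x * pd i (pd j (fun y => Real.log (f y))) x
      = pd i (pd j f) x
        - 4 * (pd i (fun y => Real.sqrt (f y)) x * pd j (fun y => Real.sqrt (f y)) x) := by
  have hlog : ContDiff ℝ (⊤ : ℕ∞) fun y => Real.log (f y) := hf.log fun y => (hpos y).ne'
  have hd : pd i (pd j f) x = pd i f x * pd j (fun y => Real.log (f y)) x
      + f x * pd i (pd j (fun y => Real.log (f y))) x := by
    rw [← pd_mul hf (hlog.pd j), funext (pd_log hf hpos j)]
  have hi := pd_sqrt hf hpos i x
  have hj := pd_sqrt hf hpos j x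
  have hl := pd_log hf hpos j x
  have hs := Real.mul_self_sqrt (hpos x).le
  have hprod : pd i f x * pd j (fun y => Real.log (f y)) x
      = 4 * (pd i (fun y => Real.sqrt (f y)) x * pd j (fun y => Real.sqrt (f y)) x) := by
    refine mul_left_cancel₀ (hpos x).ne' ?_
    calc f x * (pd i f x * pd j (fun y => Real.log (f y)) x)
        = pd i f x * pd j f x := by rw [← hl]; ring
      _ = _ := by rw [← hi, ← hj]; nth_rewrite 3 [← hs]; ring
  linarith

end PartialDerivatives

/-- For smooth `ℤⁿ`-periodic `ρ > 0` and a smooth `ℤⁿ`-periodic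
vector field `ψ`, `∫ div(ρ ∇² log ρ) · ψ = ∫ (4 ∇√ρ ⊗ ∇√ρ : ∇ψ - ρ Δ(div ψ))`
over the unit cube (the torus). -/
theorem statement6 (n : ℕ) (hn : 1 ≤ n)
    (ρ : (Fin n → ℝ) → ℝ) (ψ : (Fin n → ℝ) → Fin n → ℝ)
    (hρ : ContDiff ℝ (⊤ : ℕ∞) ρ) (hρper : ZPeriodic ρ) (hpos : ∀ x, 0 < ρ x)
    (hψ : ContDiff ℝ (⊤ : ℕ∞) ψ) (hψper : ZPeriodic ψ) :
    ∫ x in Set.Icc (0 : Fin n → ℝ) 1,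
        ∑ i, (∑ j, pd j (fun y => ρ y * pd i (pd j (fun z => Real.log (ρ z))) y) x) * ψ x i
      = ∫ x in Set.Icc (0 : Fin n → ℝ) 1,
          (4 * ∑ i, ∑ j,
              pd i (fun y => Real.sqrt (ρ y)) x * pd j (fun y => Real.sqrt (ρ y)) x *
                pd j (fun y => ψ y i) x)
            - ρ x * (∑ j, pd j (pd j (fun y => ∑ i, pd i (fun z => ψ z i) y)) x) := by
  have hψi : ∀ i, ContDiff ℝ (⊤ : ℕ∞) fun y => ψ y i := contDiff_pi.1 hψ
  have hψiper : ∀ i, ZPeriodic fun y => ψ y i := fun i x k => congrFun (hψper x k) i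
  have hlog : ContDiff ℝ (⊤ : ℕ∞) fun y => Real.log (ρ y) := hρ.log fun y => (hpos y).ne'
  have hlogper : ZPeriodic fun y => Real.log (ρ y) := fun x k => congrArg Real.log (hρper x k)
  have hsqrt : ContDiff ℝ (⊤ : ℕ∞) fun y => Real.sqrt (ρ y) := hρ.sqrt fun y => (hpos y).ne'
  let A : Fin n → Fin n → (Fin n → ℝ) → ℝ :=
    fun i j y => ρ y * pd i (pd j (fun z => Real.log (ρ z))) y
  have hA : ∀ i j, ContDiff ℝ (⊤ : ℕ∞) (A i j) := fun i j => hρ.mul ((hlog.pd j).pd i)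
  have hAper : ∀ i j, ZPeriodic (A i j) := fun i j => hρper.mul ((hlogper.pd j).pd i)
  let G : Fin n → Fin n → (Fin n → ℝ) → ℝ :=
    fun i j y => A i j y * ψ y i + ρ y * pd j (pd i fun z => ψ z i) y
  let H : Fin n → Fin n → (Fin n → ℝ) → ℝ := fun i j y => pd j ρ y * pd j (fun z => ψ z i) y
  have hG : ∀ i j, ContDiff ℝ (⊤ : ℕ∞) (G i j) := fun i j =>
    ((hA i j).mul (hψi i)).add (hρ.mul (((hψi i).pd i).pd j))
  have hGper : ∀ i j, ZPeriodic (G i j) := fun i j =>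
    ((hAper i j).mul (hψiper i)).add (hρper.mul (((hψiper i).pd i).pd j))
  have hH : ∀ i j, ContDiff ℝ (⊤ : ℕ∞) (H i j) := fun i j => (hρ.pd j).mul ((hψi i).pd j)
  have hHper : ∀ i j, ZPeriodic (H i j) := fun i j => (hρper.pd j).mul ((hψiper i).pd j)
  have hlap : ∀ j, pd j (pd j (fun y => ∑ i, pd i (fun z => ψ z i) y))
      = fun x => ∑ i, pd j (pd j (pd i fun z => ψ z i)) x := fun j => by
    rw [pd_sum _ fun i => (hψi i).pd i, pd_sum _ fun i => ((hψi i).pd i).pd j]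
  have hint : ∀ {g : (Fin n → ℝ) → ℝ}, Continuous g →
      MeasureTheory.IntegrableOn g (Set.Icc (0 : Fin n → ℝ) 1) := fun hg =>
    hg.continuousOn.integrableOn_compact isCompact_Icc
  have hterm : ∀ i j x, pd j (A i j) x * ψ x i
      - (4 * (pd i (fun y => Real.sqrt (ρ y)) x * pd j (fun y => Real.sqrt (ρ y)) x *
          pd j (fun y => ψ y i) x) - ρ x * pd j (pd j (pd i fun z => ψ z i)) x)
      = pd j (G i j) x - pd i (H i j) x := fun i j x => by
    have hGx : pd j (G i j) x = _ :=
      pd_add ((hA i j).mul (hψi i)) (hρ.mul (((hψi i).pd i).pd j)) j x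
    have hHx : pd i (H i j) x = _ := pd_mul (hρ.pd j) ((hψi i).pd j) i x
    have hAx : A i j x = _ := mul_pd_pd_log hρ hpos i j x
    rw [hGx, hHx, pd_mul (hA i j) (hψi i), pd_mul hρ (((hψi i).pd i).pd j), hAx,
      pd_comm (hψi i) i j]
    ring
  rw [← sub_eq_zero, ← MeasureTheory.integral_sub]
  · calc _ = ∫ x in Set.Icc (0 : Fin n → ℝ) 1,
          ∑ i, ∑ j, (pd j (G i j) x - pd i (H i j) x) := by
          congr 1
          funext x
          simp only [hlap, ← hterm, Finset.sum_sub_distrib, Finset.sum_mul, Finset.mul_sum]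
          congr 2
          exact Finset.sum_comm
      _ = 0 := by
          have hcont : ∀ i j, Continuous fun x => pd j (G i j) x - pd i (H i j) x :=
            fun i j => ((hG i j).pd j).continuous.sub ((hH i j).pd i).continuous
          rw [MeasureTheory.integral_finsetSum _ fun i _ =>
            hint (continuous_finsetSum _ fun j _ => hcont i j)]
          refine Finset.sum_eq_zero fun i _ => ?_
          rw [MeasureTheory.integral_finsetSum _ fun j _ => hint (hcont i j)]
          refine Finset.sum_eq_zero fun j _ => ?_
          rw [MeasureTheory.integral_sub (hint ((hG i j).pd j).continuous)
            (hint ((hH i j).pd i).continuous), integral_pd_eq_zero (hG i j) (hGper i j),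
            integral_pd_eq_zero (hH i j) (hHper i j), sub_zero]
  · exact hint (continuous_finsetSum _ fun i _ => (continuous_finsetSum _ fun j _ =>
      ((hA i j).pd j).continuous).mul (hψi i).continuous)
  · simp only [hlap]
    exact hint ((continuous_const.mul (continuous_finsetSum _ fun i _ =>
      continuous_finsetSum _ fun j _ => ((hsqrt.pd i).continuous.mul
        (hsqrt.pd j).continuous).mul ((hψi i).pd j).continuous)).sub
      (hρ.continuous.mul (continuous_finsetSum _ fun j _ => continuous_finsetSum _ fun i _ =>
        ((((hψi i).pd i).pd j).pd j).continuous)))
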